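/- Let m > 1/2. There exists a constant C_m > 0, independent of σ, such that for all σ ≥ 0 and all u, v ∈ G^m_σ, the pointwise product uv lies in G^m_σ and ‖uv‖_{G^m_σ} ≤ C_m ‖u‖_{G^m_σ} ‖v‖_{G^m_σ}. -/

import Mathlib

open MeasureTheory

noncomputable def fHat {E : Type*} [NormedAddCommGroup E] [NormedSpace ℂ E]
    (u : ℝ → E) (k : ℝ) : E :=
  (Real.sqrt (2 * Real.pi))⁻¹ • ∫ x : ℝ, Complex.exp (-(Complex.I * k * x)) • u x

noncomputable def gevreyWeight (m σ k : ℝ) : ℝ :=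
  Real.exp (2 * σ * (1 + |k|)) * (1 + k ^ 2) ^ m

def MemGevrey {E : Type*} [NormedAddCommGroup E] [NormedSpace ℂ E]
    (m σ : ℝ) (u : ℝ → E) : Prop :=
  Integrable u ∧ Integrable (fun k => gevreyWeight m σ k * ‖fHat u k‖ ^ 2)

noncomputable def gevreyNorm {E : Type*} [NormedAddCommGroup E] [NormedSpace ℂ E]
    (m σ : ℝ) (u : ℝ → E) : ℝ :=
  Real.sqrt (∫ k : ℝ, gevreyWeight m σ k * ‖fHat u k‖ ^ 2)

def GevreyContOn {E : Type*} [NormedAddCommGroup E] [NormedSpace ℂ E]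
    (m σ : ℝ) (u : ℝ → ℝ → E) (s : Set ℝ) : Prop :=
  (∀ t ∈ s, MemGevrey m σ (u t)) ∧
  ∀ t ∈ s, Filter.Tendsto (fun t' => gevreyNorm m σ (fun x => u t' x - u t x))
      (nhdsWithin t s) (nhds 0)

def GevreyC1On {E : Type*} [NormedAddCommGroup E] [NormedSpace ℂ E]
    (m σ : ℝ) (u : ℝ → ℝ → E) (s : Set ℝ) : Prop :=
  ∃ v : ℝ → ℝ → E,
    (∀ t ∈ s, Filter.Tendsto
      (fun t' => gevreyNorm m σ (fun x => (t' - t)⁻¹ • (u t' x - u t x) - v t x))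
      (nhdsWithin t (s \ {t})) (nhds 0)) ∧
    GevreyContOn m σ v s

open scoped FourierTransform Convolution

theorem integral_fourier_mul_eq_mul_fourier {f g : ℝ → ℂ} (hf : Integrable f) (hg : Integrable g) :
    ∫ ξ, 𝓕 f ξ * g ξ = ∫ x, f x * 𝓕 g x := by
  simpa using! VectorFourier.integral_fourierIntegral_smul_eq_flip (L := innerₗ ℝ)
    Real.continuous_fourierChar continuous_inner hf hg

theorem integral_fourierInv_mul_eq_mul_fourierInv {f g : ℝ → ℂ} (hf : Integrable f)
    (hg : Integrable g) : ∫ ξ, 𝓕⁻ f ξ * g ξ = ∫ x, f x * 𝓕⁻ g x := by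
  rw [Real.fourierInv_eq_fourier_comp_neg g, ← integral_fourier_mul_eq_mul_fourier hf hg.comp_neg,
    ← integral_neg_eq_self]
  simp [Real.fourierInv_eq_fourier_neg]

theorem continuous_fourier_of_integrable {f : ℝ → ℂ} (hf : Integrable f) : Continuous (𝓕 f) :=
  VectorFourier.fourierIntegral_continuous Real.continuous_fourierChar
    (by fun_prop) hf

theorem ae_eq_fourierInv_fourier {f : ℝ → ℂ} (hf : Integrable f) (hf' : Integrable (𝓕 f)) :
    f =ᵐ[volume] 𝓕⁻ (𝓕 f) := by
  have hc : Continuous (𝓕⁻ (𝓕 f)) := by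
    rw [Real.fourierInv_eq_fourier_comp_neg]
    exact continuous_fourier_of_integrable hf'.comp_neg
  refine ae_eq_of_integral_contDiff_smul_eq hf.locallyIntegrable hc.locallyIntegrable ?_
  intro g hg hgs
  have hs : HasCompactSupport (fun x => (g x : ℂ)) := hgs.comp_left (g := Complex.ofReal) rfl
  have hd : ContDiff ℝ (⊤ : ℕ∞) (fun x => (g x : ℂ)) := Complex.ofRealCLM.contDiff.comp hg
  let φ : SchwartzMap ℝ ℂ := hs.toSchwartzMap hd
  let ψ : SchwartzMap ℝ ℂ := 𝓕⁻ φ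
  have hψ : 𝓕 (ψ : ℝ → ℂ) = fun x => (g x : ℂ) := by
    rw [← SchwartzMap.fourier_coe, FourierTransform.fourier_fourierInv_eq]
    rfl
  have hψ' : 𝓕⁻ (fun x => (g x : ℂ)) = ψ := by
    rw [SchwartzMap.fourierInv_coe]; rfl
  have hφ : Integrable (fun x => (g x : ℂ)) := φ.integrable
  calc ∫ x, g x • f x = ∫ x, 𝓕 (ψ : ℝ → ℂ) x * f x := by simp [hψ]
    _ = ∫ x, ψ x * 𝓕 f x := integral_fourier_mul_eq_mul_fourier ψ.integrable hf
    _ = ∫ x, 𝓕⁻ (fun x => (g x : ℂ)) x * 𝓕 f x := by rw [hψ']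
    _ = ∫ x, (g x : ℂ) * 𝓕⁻ (𝓕 f) x := integral_fourierInv_mul_eq_mul_fourierInv hφ hf'
    _ = ∫ x, g x • 𝓕⁻ (𝓕 f) x := by simp

theorem integrable_mul_of_integrable_fourier {f g : ℝ → ℂ} (hf : Integrable f)
    (hg : Integrable g) (hg' : Integrable (𝓕 g)) : Integrable (fun x => f x * g x) := by
  refine hf.mul_bdd (c := ∫ x, ‖𝓕 g x‖) hg.aestronglyMeasurable ?_
  filter_upwards [ae_eq_fourierInv_fourier hg hg'] with x hx
  rw [hx, Real.fourierInv_eq]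
  exact (norm_integral_le_integral_norm _).trans_eq (by simp)

theorem fourier_mul_eq_integral {f g : ℝ → ℂ} (hf : Integrable f)
    (hg : Integrable g) (hg' : Integrable (𝓕 g)) (k : ℝ) :
    𝓕 (fun x => f x * g x) k = ∫ l, 𝓕 f (k - l) * 𝓕 g l := by
  have hi : Integrable (fun x => Real.fourierChar (-(x * k)) • f x) := by
    simpa [mul_comm] using! (Real.fourierIntegral_convergent_iff k).2 hf
  have hshift (l : ℝ) : 𝓕⁻ (fun x => Real.fourierChar (-(x * k)) • f x) l = 𝓕 f (k - l) := by
    rw [Real.fourierInv_eq, Real.fourier_real_eq]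
    refine integral_congr_ae (.of_forall fun x => ?_)
    simp only [smul_smul, ← AddChar.map_add_eq_mul]
    congr 2
    simp
    ring
  simp_rw [← hshift]
  rw [integral_fourierInv_mul_eq_mul_fourierInv hi hg', Real.fourier_real_eq]
  refine integral_congr_ae ?_
  filter_upwards [ae_eq_fourierInv_fourier hg hg'] with x hx
  rw [← hx, smul_mul_assoc]

theorem fHat_eq_fourier (u : ℝ → ℂ) (k : ℝ) :
    fHat u k = (Real.sqrt (2 * Real.pi))⁻¹ • 𝓕 u (k / (2 * Real.pi)) := by
  rw [fHat, Real.fourier_real_eq_integral_exp_smul]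
  congr 1
  refine integral_congr_ae (.of_forall fun x => ?_)
  dsimp only
  congr 2
  push_cast
  field_simp

theorem continuous_fHat {u : ℝ → ℂ} (hu : Integrable u) : Continuous (fHat u) := by
  have := continuous_fourier_of_integrable hu
  rw [funext (fHat_eq_fourier u)]
  fun_prop

theorem integrable_fourier_of_integrable_fHat {u : ℝ → ℂ} (hu : Integrable (fHat u)) :
    Integrable (𝓕 u) := by
  rw [funext (fHat_eq_fourier u)] at hu
  have h := (integrable_smul_iff (c := (Real.sqrt (2 * Real.pi))⁻¹) (by positivity) _).1 hu
  exact (integrable_comp_div_iff (𝓕 u) (by positivity)).1 h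

theorem fHat_mul_eq_integral {u v : ℝ → ℂ} (hu : Integrable u) (hv : Integrable v)
    (hv' : Integrable (fHat v)) (k : ℝ) :
    fHat (fun x => u x * v x) k =
      (Real.sqrt (2 * Real.pi))⁻¹ • ∫ l, fHat u (k - l) * fHat v l := by
  have hpi : (0 : ℝ) < 2 * Real.pi := by positivity
  have h := Measure.integral_comp_div
    (fun l => 𝓕 u (k / (2 * Real.pi) - l) * 𝓕 v l) (2 * Real.pi)
  rw [fHat_eq_fourier, fourier_mul_eq_integral hu hv (integrable_fourier_of_integrable_fHat hv')]
  simp_rw [fHat_eq_fourier, smul_mul_smul_comm, integral_smul, sub_div, h, abs_of_pos hpi,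
    smul_smul]
  congr 1
  rw [← mul_inv, Real.mul_self_sqrt hpi.le]
  field_simp

theorem sq_integral_le_mul_integral {α : Type*} [MeasurableSpace α] {μ : Measure α}
    {f a b : α → ℝ} (hab : ∀ x, f x ^ 2 ≤ a x * b x) (ha : Integrable a μ) (hb : Integrable b μ)
    (ha0 : ∀ x, 0 ≤ a x) (hb0 : ∀ x, 0 ≤ b x) :
    (∫ x, f x ∂μ) ^ 2 ≤ (∫ x, a x ∂μ) * ∫ x, b x ∂μ := by
  by_cases hf : Integrable f μ
  · have key (t : ℝ) :
        0 ≤ (∫ x, a x ∂μ) * (t * t) + (-2 * ∫ x, f x ∂μ) * t + ∫ x, b x ∂μ := by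
      have h1 : 0 ≤ ∫ x, (a x * (t * t) + (-2 * f x) * t + b x) ∂μ := by
        refine integral_nonneg fun x => ?_
        have h := hab x
        have h0 := ha0 x
        rcases h0.eq_or_lt with h0 | h0
        · have : f x = 0 := by
            rw [← h0, zero_mul] at h
            exact pow_eq_zero_iff two_ne_zero |>.1 (le_antisymm h (sq_nonneg _))
          simp [← h0, this, hb0 x]
        · refine nonneg_of_mul_nonneg_right (a := a x) ?_ h0
          nlinarith [sq_nonneg (a x * t - f x)]
      rwa [integral_add (by fun_prop) hb, integral_add (by fun_prop) (by fun_prop),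
        integral_mul_const, integral_mul_const, integral_const_mul] at h1
    have := discrim_le_zero key
    rw [discrim] at this
    linarith
  · rw [integral_undef hf]
    have := integral_nonneg (μ := μ) (f := a) ha0
    have := integral_nonneg (μ := μ) (f := b) hb0
    simp only [ne_eq, OfNat.ofNat_ne_zero, not_false_eq_true, zero_pow]
    positivity

theorem gevreyWeight_pos (m σ k : ℝ) : 0 < gevreyWeight m σ k := by
  unfold gevreyWeight; positivity

theorem continuous_gevreyWeight (m σ : ℝ) : Continuous (gevreyWeight m σ) := by
  unfold gevreyWeight
  refine Continuous.mul (by fun_prop) (Continuous.rpow_const (by fun_prop) fun k => ?_)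
  exact Or.inl (by positivity)

theorem inv_gevreyWeight_le {σ : ℝ} (hσ : 0 ≤ σ) (m k : ℝ) :
    (gevreyWeight m σ k)⁻¹ ≤ (1 + k ^ 2) ^ (-m) := by
  rw [gevreyWeight, mul_inv, Real.rpow_neg (by positivity)]
  refine mul_le_of_le_one_left (by positivity) (inv_le_one_of_one_le₀ ?_)
  exact Real.one_le_exp (by positivity)

theorem integrable_one_add_sq_rpow_neg {m : ℝ} (hm : 1 / 2 < m) :
    Integrable (fun k : ℝ => (1 + k ^ 2) ^ (-m)) := by
  have h := integrable_rpow_neg_one_add_norm_sq (E := ℝ) (μ := volume) (r := 2 * m)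
    (by simp; linarith)
  simpa [neg_div] using h

theorem gevreyWeight_le_mul {m σ : ℝ} (hm : 0 ≤ m) (hσ : 0 ≤ σ) (k l : ℝ) :
    gevreyWeight m σ k ≤ 4 ^ m * ((1 + (k - l) ^ 2) ^ (-m) + (1 + l ^ 2) ^ (-m)) *
      (gevreyWeight m σ (k - l) * gevreyWeight m σ l) := by
  have h1 : (1 + k ^ 2) ^ m ≤ 4 ^ m * ((1 + (k - l) ^ 2) ^ m + (1 + l ^ 2) ^ m) := by
    have key (x y : ℝ) (hxy : x ^ 2 ≤ y ^ 2) (hk : k = x + y) :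
        (1 + k ^ 2) ^ m ≤ 4 ^ m * (1 + y ^ 2) ^ m := by
      rw [← Real.mul_rpow (by norm_num) (by positivity)]
      refine Real.rpow_le_rpow (by positivity) ?_ hm
      subst hk
      nlinarith [sq_nonneg (x - y)]
    have p1 : 0 ≤ (1 + (k - l) ^ 2) ^ m := by positivity
    have p2 : 0 ≤ (1 + l ^ 2) ^ m := by positivity
    have p3 : (0 : ℝ) ≤ 4 ^ m := by positivity
    rcases le_total (l ^ 2) ((k - l) ^ 2) with h | h
    · exact (key _ _ h (by ring)).trans (by gcongr; linarith)
    · exact (key _ _ h (by ring)).trans (by gcongr; linarith)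
  have h2 : Real.exp (2 * σ * (1 + |k|)) ≤
      Real.exp (2 * σ * (1 + |k - l|)) * Real.exp (2 * σ * (1 + |l|)) := by
    rw [← Real.exp_add, ← mul_add]
    refine Real.exp_le_exp.2 (mul_le_mul_of_nonneg_left ?_ (by positivity))
    have := abs_add_le (k - l) l
    rw [sub_add_cancel] at this
    linarith
  unfold gevreyWeight
  refine (mul_le_mul h2 h1 (by positivity) (by positivity)).trans_eq ?_
  rw [Real.rpow_neg (by positivity), Real.rpow_neg (by positivity)]
  have p1 : (1 + (k - l) ^ 2) ^ m ≠ 0 := by positivity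
  have p2 : (1 + l ^ 2) ^ m ≠ 0 := by positivity
  field_simp
  ring

theorem MemGevrey.integrable_fHat {m σ : ℝ} (hm : 1 / 2 < m) (hσ : 0 ≤ σ) {u : ℝ → ℂ}
    (hu : MemGevrey m σ u) : Integrable (fHat u) := by
  refine ((integrable_one_add_sq_rpow_neg hm).add hu.2).mono'
    (continuous_fHat hu.1).aestronglyMeasurable (.of_forall fun k => ?_)
  have h := inv_gevreyWeight_le hσ m k
  have hw := gevreyWeight_pos m σ k
  refine le_trans ?_ (add_le_add_left h _)
  rw [← sub_nonneg]
  refine nonneg_of_mul_nonneg_right (a := gevreyWeight m σ k) ?_ hw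
  rw [mul_sub, mul_add, mul_inv_cancel₀ hw.ne']
  nlinarith [sq_nonneg (gevreyWeight m σ k * ‖fHat u k‖ - 1),
    sq_nonneg (gevreyWeight m σ k * ‖fHat u k‖)]

theorem gevreyWeight_mul_norm_fHat_mul_sq_le {m σ : ℝ} (hm : 1 / 2 < m) (hσ : 0 ≤ σ) {u v : ℝ → ℂ}
    (hu : MemGevrey m σ u) (hv : MemGevrey m σ v) {k : ℝ}
    (hk : Integrable fun l => (gevreyWeight m σ l * ‖fHat v l‖ ^ 2) *
      (gevreyWeight m σ (k - l) * ‖fHat u (k - l)‖ ^ 2)) :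
    gevreyWeight m σ k * ‖fHat (fun x => u x * v x) k‖ ^ 2 ≤
      ((2 * Real.pi)⁻¹ * (4 ^ m * (2 * ∫ l : ℝ, (1 + l ^ 2) ^ (-m)))) *
        ∫ l, (gevreyWeight m σ l * ‖fHat v l‖ ^ 2) *
          (gevreyWeight m σ (k - l) * ‖fHat u (k - l)‖ ^ 2) := by
  have hW := gevreyWeight_pos m σ
  have hJ := integrable_one_add_sq_rpow_neg hm
  have hJk : Integrable fun l : ℝ => (1 + (k - l) ^ 2) ^ (-m) := hJ.comp_sub_left k
  have hCS := sq_integral_le_mul_integral (μ := volume)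
    (f := fun l => ‖fHat u (k - l)‖ * ‖fHat v l‖)
    (a := fun l => (gevreyWeight m σ k)⁻¹ *
      (4 ^ m * ((1 + (k - l) ^ 2) ^ (-m) + (1 + l ^ 2) ^ (-m))))
    (b := fun l => (gevreyWeight m σ l * ‖fHat v l‖ ^ 2) *
      (gevreyWeight m σ (k - l) * ‖fHat u (k - l)‖ ^ 2))
    (fun l => ?_) (((hJk.add hJ).const_mul _).const_mul _) hk (fun l => ?_) (fun l => ?_)
  · rw [integral_const_mul, integral_const_mul, integral_add hJk hJ,
      integral_sub_left_eq_self (fun l : ℝ => (1 + l ^ 2) ^ (-m)), ← two_mul] at hCS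
    have hn : ‖fHat (fun x => u x * v x) k‖ ≤
        (Real.sqrt (2 * Real.pi))⁻¹ * ∫ l, ‖fHat u (k - l)‖ * ‖fHat v l‖ := by
      rw [fHat_mul_eq_integral hu.1 hv.1 (hv.integrable_fHat hm hσ), norm_smul,
        Real.norm_of_nonneg (by positivity)]
      gcongr
      exact (norm_integral_le_integral_norm _).trans_eq (by simp)
    calc gevreyWeight m σ k * ‖fHat (fun x => u x * v x) k‖ ^ 2
        ≤ gevreyWeight m σ k *
          ((Real.sqrt (2 * Real.pi))⁻¹ * ∫ l, ‖fHat u (k - l)‖ * ‖fHat v l‖) ^ 2 := by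
          have := (hW k).le
          gcongr
      _ = gevreyWeight m σ k * (2 * Real.pi)⁻¹ *
          (∫ l, ‖fHat u (k - l)‖ * ‖fHat v l‖) ^ 2 := by
          rw [mul_pow, inv_pow, Real.sq_sqrt (by positivity), mul_assoc]
      _ ≤ _ := mul_le_mul_of_nonneg_left hCS (mul_nonneg (hW k).le (by positivity))
      _ = _ := by
          have := (hW k).ne'
          field_simp
  · have h := gevreyWeight_le_mul (by linarith : 0 ≤ m) hσ k l
    rw [mul_assoc, ← div_eq_inv_mul, le_div_iff₀ (hW k)]
    calc _ ≤ (‖fHat u (k - l)‖ * ‖fHat v l‖) ^ 2 * _ :=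
          mul_le_mul_of_nonneg_left h (by positivity)
      _ = _ := by ring
  · have := hW k
    positivity
  · have := hW l
    have := hW (k - l)
    positivity

/-- For `m > 1/2` the Gevrey space `G^m_σ` is an algebra, with a
product constant independent of `σ ≥ 0`. -/
theorem gevrey_algebra (m : ℝ) (hm : 1 / 2 < m) :
    ∃ C : ℝ, 0 < C ∧
      ∀ σ : ℝ, 0 ≤ σ → ∀ u v : ℝ → ℂ, MemGevrey m σ u → MemGevrey m σ v →
        MemGevrey m σ (fun x => u x * v x) ∧
        gevreyNorm m σ (fun x => u x * v x) ≤ C * gevreyNorm m σ u * gevreyNorm m σ v := by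
  set K : ℝ := (2 * Real.pi)⁻¹ * (4 ^ m * (2 * ∫ l : ℝ, (1 + l ^ 2) ^ (-m)))
  have hK0 : 0 ≤ K := by
    have : 0 ≤ ∫ l : ℝ, (1 + l ^ 2) ^ (-m) := integral_nonneg fun l => by positivity
    positivity
  refine ⟨Real.sqrt K + 1, by positivity, fun σ hσ u v hu hv => ?_⟩
  have huv := integrable_mul_of_integrable_fourier hu.1 hv.1
    (integrable_fourier_of_integrable_fHat (hv.integrable_fHat hm hσ))
  have hconv := (hv.2.integrable_convolution (ContinuousLinearMap.mul ℝ ℝ) hu.2).const_mul K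
  have hle : ∀ᵐ k, gevreyWeight m σ k * ‖fHat (fun x => u x * v x) k‖ ^ 2 ≤
      K * ((fun k => gevreyWeight m σ k * ‖fHat v k‖ ^ 2)
        ⋆[ContinuousLinearMap.mul ℝ ℝ, volume]
          fun k => gevreyWeight m σ k * ‖fHat u k‖ ^ 2) k := by
    filter_upwards [hv.2.ae_convolution_exists (ContinuousLinearMap.mul ℝ ℝ) hu.2] with k hk
    exact gevreyWeight_mul_norm_fHat_mul_sq_le hm hσ hu hv hk
  have hint : Integrable fun k => gevreyWeight m σ k * ‖fHat (fun x => u x * v x) k‖ ^ 2 := by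
    refine hconv.mono' ((continuous_gevreyWeight m σ).mul
      ((continuous_fHat huv).norm.pow 2)).aestronglyMeasurable ?_
    filter_upwards [hle] with k hk
    rwa [Real.norm_of_nonneg (mul_nonneg (gevreyWeight_pos m σ k).le (by positivity))]
  refine ⟨⟨huv, hint⟩, ?_⟩
  have hmain := integral_mono_ae hint hconv hle
  rw [integral_const_mul, integral_convolution _ hv.2 hu.2, ContinuousLinearMap.mul_apply'] at hmain
  have hnonneg (w : ℝ → ℂ) : 0 ≤ ∫ k, gevreyWeight m σ k * ‖fHat w k‖ ^ 2 :=
    integral_nonneg fun k => mul_nonneg (gevreyWeight_pos m σ k).le (by positivity)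
  calc gevreyNorm m σ (fun x => u x * v x)
      ≤ Real.sqrt (K * ((∫ k, gevreyWeight m σ k * ‖fHat v k‖ ^ 2) *
          ∫ k, gevreyWeight m σ k * ‖fHat u k‖ ^ 2)) := Real.sqrt_le_sqrt hmain
    _ = Real.sqrt K * gevreyNorm m σ u * gevreyNorm m σ v := by
      rw [Real.sqrt_mul hK0, Real.sqrt_mul (hnonneg v), gevreyNorm, gevreyNorm]
      ring
    _ ≤ (Real.sqrt K + 1) * gevreyNorm m σ u * gevreyNorm m σ v := by
      have hu0 : 0 ≤ gevreyNorm m σ u := Real.sqrt_nonneg _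
      have hv0 : 0 ≤ gevreyNorm m σ v := Real.sqrt_nonneg _
      gcongr
      linarith
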